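/- Let a₁, a₂, a₃ > 0, β ∈ [0, π] and 0 < μ < 1. Let (ω_b, ω_t) be a gap of Σ(β) of type (ii) or of type (iii). Then there exists ω₁ ∈ (ω_b, ω_t) such that there is a square-summable u : ℤ² → ℂ, not identically zero, satisfying the system (FD) with frequency ω₁; equivalently μ = 1 − F_β(ω₁). (The perturbed operator 𝒜^μ(β) has at least one eigenvalue ω₁² in each gap of type (ii) or (iii).) -/

import Mathlib

open Real MeasureTheory Set Filter Topology

noncomputable section

/-- The dispersion relation `D_β(ω, k₁, k₂)`. -/
def Dfun (a₁ a₂ a₃ β ω k₁ k₂ : ℝ) : ℝ :=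
  Real.sin (ω * a₂) * Real.sin (ω * a₃) * (Real.cos (ω * a₁) - Real.cos k₁)
    + Real.sin (ω * a₃) * Real.sin (ω * a₁) * (Real.cos (ω * a₂) - Real.cos k₂)
    + Real.sin (ω * a₁) * Real.sin (ω * a₂) * (Real.cos (ω * a₃) - Real.cos β)

/-- The dispersion set `Σ(β)`. -/
def dispSet (a₁ a₂ a₃ β : ℝ) : Set ℝ :=
  {ω | 0 < ω ∧ ∃ k₁ ∈ Icc (0 : ℝ) π, ∃ k₂ ∈ Icc (0 : ℝ) π, Dfun a₁ a₂ a₃ β ω k₁ k₂ = 0}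

/-- `φ_β(ω) = (cos(ω a₃) − cos β)/sin(ω a₃)`. -/
def phiB (a₃ β ω : ℝ) : ℝ := (Real.cos (ω * a₃) - Real.cos β) / Real.sin (ω * a₃)

/-- `f(ξ, η, ω)`. -/
def fFun (a₁ a₂ ξ η ω : ℝ) : ℝ :=
  (Real.cos ξ - Real.cos (ω * a₁)) / Real.sin (ω * a₁)
    + (Real.cos η - Real.cos (ω * a₂)) / Real.sin (ω * a₂)

/-- `g_β(ω)`. -/
def gB (a₁ a₂ a₃ β ω : ℝ) : ℝ :=
  Real.cos (ω * a₁) / Real.sin (ω * a₁) + Real.cos (ω * a₂) / Real.sin (ω * a₂)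
    + phiB a₃ β ω

/-- The set `T = {πn/a₁ : n ≥ 1} ∪ {πn/a₂ : n ≥ 1}`. -/
def Tset (a₁ a₂ : ℝ) : Set ℝ :=
  {x | ∃ n : ℕ, 1 ≤ n ∧ x = π * n / a₁} ∪ {x | ∃ n : ℕ, 1 ≤ n ∧ x = π * n / a₂}

/-- The set `𝒲(β)`. -/
def Wset (a₃ β : ℝ) : Set ℝ :=
  if β = 0 ∨ β = π then
    {x | ∃ n : ℕ, 1 ≤ n ∧ x = β / a₃ + (2 * n + 1) * π / a₃}
  else
    {x | ∃ n : ℕ, 1 ≤ n ∧ x = π * n / a₃}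

/-- `(ω_b, ω_t)` is a gap of the dispersion set `Σ(β)`. -/
def IsGap (a₁ a₂ a₃ β ωb ωt : ℝ) : Prop :=
  0 < ωb ∧ ωb < ωt ∧ ωb ∈ dispSet a₁ a₂ a₃ β ∧ ωt ∈ dispSet a₁ a₂ a₃ β ∧
    Ioo ωb ωt ∩ dispSet a₁ a₂ a₃ β = ∅

/-- The finite-difference system (FD). -/
def SatisfiesFD (a₁ a₂ a₃ β μ ω : ℝ) (u : ℤ × ℤ → ℂ) : Prop :=
  (∀ k ℓ : ℤ, (k, ℓ) ≠ ((0 : ℤ), (0 : ℤ)) →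
    u (k + 1, ℓ) / (Real.sin (ω * a₁) : ℂ) + u (k - 1, ℓ) / (Real.sin (ω * a₁) : ℂ)
      + u (k, ℓ + 1) / (Real.sin (ω * a₂) : ℂ) + u (k, ℓ - 1) / (Real.sin (ω * a₂) : ℂ)
      - 2 * (gB a₁ a₂ a₃ β ω : ℂ) * u (k, ℓ) = 0)
  ∧ u (1, 0) / (Real.sin (ω * a₁) : ℂ) + u (-1, 0) / (Real.sin (ω * a₁) : ℂ)
      + u (0, 1) / (Real.sin (ω * a₂) : ℂ) + u (0, -1) / (Real.sin (ω * a₂) : ℂ)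
      - 2 * (gB a₁ a₂ a₃ β ω : ℂ) * u (0, 0)
      = 2 * ((μ - 1 : ℝ) : ℂ) * (phiB a₃ β ω : ℂ) * u (0, 0)

/-- `I_β(ω) = (1/(4π²)) ∫_{(0,2π)²} φ_β(ω)/(φ_β(ω) − f(ξ,η,ω)) dξ dη`. -/
def IB (a₁ a₂ a₃ β ω : ℝ) : ℝ :=
  (1 / (4 * π ^ 2)) *
    ∫ p in (Ioo (0 : ℝ) (2 * π)) ×ˢ (Ioo (0 : ℝ) (2 * π)),
      phiB a₃ β ω / (phiB a₃ β ω - fFun a₁ a₂ p.1 p.2 ω)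

/-- `F_β(ω) = I_β(ω)⁻¹`. -/
def FB (a₁ a₂ a₃ β ω : ℝ) : ℝ := (IB a₁ a₂ a₃ β ω)⁻¹


/-- The fundamental cell `(0, 2π)²` of the torus. -/
abbrev torusCell : Set (ℝ × ℝ) := Ioo (0 : ℝ) (2 * π) ×ˢ Ioo (0 : ℝ) (2 * π)

/-- The character `(ξ, η) ↦ exp(i(kξ + ℓη))` indexed by `p = (k, ℓ)`. -/
def torusChar (p : ℤ × ℤ) (x : ℝ × ℝ) : ℂ :=
  Complex.exp (Complex.I * (p.1 : ℂ) * (x.1 : ℂ)) * Complex.exp (Complex.I * (p.2 : ℂ) * (x.2 : ℂ))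

instance isFiniteMeasure_restrict_torusCell :
    IsFiniteMeasure ((volume : Measure (ℝ × ℝ)).restrict torusCell) := by
  refine ⟨?_⟩
  rw [Measure.restrict_apply_univ, Measure.volume_eq_prod, Measure.prod_prod]
  simp [ENNReal.mul_lt_top]

theorem measurableSet_torusCell : MeasurableSet torusCell :=
  measurableSet_Ioo.prod measurableSet_Ioo

theorem volume_real_torusCell : (volume : Measure (ℝ × ℝ)).real torusCell = 4 * π ^ 2 := by
  have h : (0 : ℝ) ≤ 2 * π := by positivity
  rw [Measure.volume_eq_prod, measureReal_prod_prod, Real.volume_real_Ioo_of_le h]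
  ring

theorem Continuous.integrableOn_torusCell {E : Type*} [NormedAddCommGroup E] {f : ℝ × ℝ → E}
    (hf : Continuous f) : IntegrableOn f torusCell := by
  refine (hf.continuousOn.integrableOn_compact
    (isCompact_Icc.prod isCompact_Icc : IsCompact (Icc (0 : ℝ) (2 * π) ×ˢ Icc (0 : ℝ) (2 * π)))).mono_set
      (prod_mono Ioo_subset_Icc_self Ioo_subset_Icc_self)

theorem continuous_torusChar (p : ℤ × ℤ) : Continuous (torusChar p) := by
  unfold torusChar; fun_prop

theorem norm_torusChar (p : ℤ × ℤ) (x : ℝ × ℝ) : ‖torusChar p x‖ = 1 := by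
  rw [torusChar, norm_mul, Complex.norm_exp, Complex.norm_exp]
  simp

theorem torusChar_add (p q : ℤ × ℤ) (x : ℝ × ℝ) :
    torusChar (p + q) x = torusChar p x * torusChar q x := by
  simp only [torusChar, Prod.fst_add, Prod.snd_add, Int.cast_add, mul_add, add_mul, Complex.exp_add]
  ring

theorem conj_torusChar (p : ℤ × ℤ) (x : ℝ × ℝ) :
    (starRingEnd ℂ) (torusChar p x) = torusChar (-p) x := by
  simp [torusChar, ← Complex.exp_conj]

theorem integral_exp_int_mul (n : ℤ) :
    ∫ x in Ioo (0 : ℝ) (2 * π), Complex.exp (Complex.I * (n : ℂ) * (x : ℂ))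
      = if n = 0 then (2 * π : ℂ) else 0 := by
  have h : (0 : ℝ) ≤ 2 * π := by positivity
  rw [← integral_Ioc_eq_integral_Ioo, ← intervalIntegral.integral_of_le h]
  split_ifs with hn
  · simp [hn]
  · rw [integral_exp_mul_complex (by simp [hn])]
    have : Complex.I * (n : ℂ) * ((2 * π : ℝ) : ℂ) = n * (2 * π * Complex.I) := by
      push_cast; ring
    rw [this, Complex.exp_int_mul_two_pi_mul_I]
    simp

theorem integral_torusChar (p : ℤ × ℤ) :
    ∫ x in torusCell, torusChar p x = if p = 0 then (4 * π ^ 2 : ℂ) else 0 := by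
  unfold torusChar
  rw [Measure.volume_eq_prod,
    setIntegral_prod_mul (fun x : ℝ => Complex.exp (Complex.I * (p.1 : ℂ) * (x : ℂ)))
      (fun x : ℝ => Complex.exp (Complex.I * (p.2 : ℂ) * (x : ℂ))), integral_exp_int_mul,
    integral_exp_int_mul]
  obtain ⟨k, l⟩ := p
  by_cases hk : k = 0 <;> by_cases hl : l = 0 <;> simp [hk, hl]
  ring

theorem memLp_torusChar (p : ℤ × ℤ) :
    MemLp (fun x => ((2 * π : ℝ) : ℂ)⁻¹ * torusChar p x) 2
      ((volume : Measure (ℝ × ℝ)).restrict torusCell) := by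
  refine MemLp.of_bound ((continuous_torusChar p).const_mul _).aestronglyMeasurable
    ‖((2 * π : ℝ) : ℂ)⁻¹‖ (ae_of_all _ fun x => ?_)
  rw [norm_mul, norm_torusChar, mul_one]

theorem inner_toLp_eq_integral {f g : ℝ × ℝ → ℂ} {ν : Measure (ℝ × ℝ)} (hf : MemLp f 2 ν)
    (hg : MemLp g 2 ν) :
    inner ℂ (hf.toLp f) (hg.toLp g) = ∫ x, (starRingEnd ℂ) (f x) * g x ∂ν := by
  rw [L2.inner_def]
  refine integral_congr_ae ?_
  filter_upwards [hf.coeFn_toLp, hg.coeFn_toLp] with x h1 h2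
  rw [h1, h2, RCLike.inner_apply, mul_comm]

theorem orthonormal_torusChar :
    Orthonormal ℂ (fun p : ℤ × ℤ => (memLp_torusChar p).toLp _) := by
  rw [orthonormal_iff_ite]
  intro p q
  rw [inner_toLp_eq_integral]
  have h : ∀ x, (starRingEnd ℂ) (((2 * π : ℝ) : ℂ)⁻¹ * torusChar p x)
      * (((2 * π : ℝ) : ℂ)⁻¹ * torusChar q x)
      = (4 * π ^ 2 : ℂ)⁻¹ * torusChar (-p + q) x := by
    intro x
    rw [map_mul, conj_torusChar, torusChar_add, map_inv₀, Complex.conj_ofReal]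
    have : (π : ℂ) ≠ 0 := by exact_mod_cast Real.pi_ne_zero
    push_cast
    field_simp
    ring
  simp only [h]
  rw [integral_const_mul, integral_torusChar]
  have : (π : ℂ) ≠ 0 := by exact_mod_cast Real.pi_ne_zero
  by_cases hpq : p = q
  · subst hpq; simp; field_simp
  · have : -p + q ≠ 0 := fun h0 => hpq (by rw [neg_add_eq_zero] at h0; exact h0)
    simp [hpq, this]

/-- Fourier coefficient of `g` at `p` for the cell `(0, 2π)²`. -/
def torusCoeff (g : ℝ × ℝ → ℝ) (p : ℤ × ℤ) : ℂ :=
  (1 / (4 * π ^ 2) : ℂ) * ∫ x in torusCell, torusChar (-p) x * (g x : ℂ)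

theorem summable_norm_sq_torusCoeff {g : ℝ × ℝ → ℝ} (hg : Continuous g) {C : ℝ}
    (hC : ∀ x, |g x| ≤ C) : Summable fun p => ‖torusCoeff g p‖ ^ 2 := by
  have hmem : MemLp (fun x => (g x : ℂ)) 2 ((volume : Measure (ℝ × ℝ)).restrict torusCell) := by
    refine MemLp.of_bound (by fun_prop) C (ae_of_all _ fun x => ?_)
    rw [Complex.norm_real]; exact hC x
  have h := (orthonormal_torusChar.inner_products_summable (hmem.toLp _)).mul_left
    (‖((2 * π : ℝ) : ℂ)⁻¹‖ ^ 2)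
  refine h.congr fun p => ?_
  rw [← mul_pow, ← norm_mul, inner_toLp_eq_integral, torusCoeff, ← integral_const_mul,
    ← integral_const_mul]
  congr 3 with x
  rw [map_mul, conj_torusChar, map_inv₀, Complex.conj_ofReal]
  have : (π : ℂ) ≠ 0 := by exact_mod_cast Real.pi_ne_zero
  push_cast
  field_simp
  ring

theorem torusChar_neighbours (p : ℤ × ℤ) (x : ℝ × ℝ) :
    torusChar (p + (1, 0)) x + torusChar (p - (1, 0)) x = 2 * Real.cos x.1 * torusChar p x ∧
    torusChar (p + (0, 1)) x + torusChar (p - (0, 1)) x = 2 * Real.cos x.2 * torusChar p x := by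
  simp only [sub_eq_add_neg, torusChar_add]
  constructor <;>
  · rw [Complex.ofReal_cos, Complex.cos]
    simp [torusChar]
    ring_nf

theorem torusCoeff_laplace {a₁ a₂ a₃ β ω : ℝ} {g : ℝ × ℝ → ℝ} (hg : Continuous g)
    (hinv : ∀ x, g x * (phiB a₃ β ω - fFun a₁ a₂ x.1 x.2 ω) = 1) (p : ℤ × ℤ) :
    torusCoeff g (p + (1, 0)) / (Real.sin (ω * a₁) : ℂ)
      + torusCoeff g (p - (1, 0)) / (Real.sin (ω * a₁) : ℂ)
      + torusCoeff g (p + (0, 1)) / (Real.sin (ω * a₂) : ℂ)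
      + torusCoeff g (p - (0, 1)) / (Real.sin (ω * a₂) : ℂ)
      - 2 * (gB a₁ a₂ a₃ β ω : ℂ) * torusCoeff g p = if p = 0 then -2 else 0 := by
  have hi : ∀ q : ℤ × ℤ, Integrable (fun x => torusChar q x * (g x : ℂ))
      (volume.restrict torusCell) := fun q =>
    Continuous.integrableOn_torusCell
      ((continuous_torusChar q).mul (Complex.continuous_ofReal.comp hg))
  have key : ∀ x, (torusChar (-(p + (1, 0))) x * (g x : ℂ) / (Real.sin (ω * a₁) : ℂ)
      + torusChar (-(p - (1, 0))) x * (g x : ℂ) / (Real.sin (ω * a₁) : ℂ)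
      + torusChar (-(p + (0, 1))) x * (g x : ℂ) / (Real.sin (ω * a₂) : ℂ)
      + torusChar (-(p - (0, 1))) x * (g x : ℂ) / (Real.sin (ω * a₂) : ℂ)
      - 2 * (gB a₁ a₂ a₃ β ω : ℂ) * (torusChar (-p) x * (g x : ℂ))) = -2 * torusChar (-p) x := by
    intro x
    obtain ⟨h1, h2⟩ := torusChar_neighbours (-p) x
    have e1 : -(p + (1, 0)) = -p - (1, 0) := by abel
    have e2 : -(p - (1, 0)) = -p + (1, 0) := by abel
    have e3 : -(p + (0, 1)) = -p - (0, 1) := by abel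
    have e4 : -(p - (0, 1)) = -p + (0, 1) := by abel
    rw [e1, e2, e3, e4]
    have h3 := congrArg (fun r : ℝ => (r : ℂ)) (hinv x)
    simp only [fFun, gB] at h3 ⊢
    push_cast at h1 h2 h3 ⊢
    simp only [div_eq_mul_inv] at h3 ⊢
    linear_combination (g x * (Complex.sin (ω * a₁))⁻¹ : ℂ) * h1
      + (g x * (Complex.sin (ω * a₂))⁻¹ : ℂ) * h2 - 2 * torusChar (-p) x * h3
  have hI := congrArg (fun F : ℝ × ℝ → ℂ => (1 / (4 * π ^ 2) : ℂ) * ∫ x in torusCell, F x)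
    (funext key)
  rw [integral_sub, integral_add, integral_add, integral_add, integral_const_mul,
    integral_const_mul, integral_div, integral_div, integral_div, integral_div,
    integral_torusChar] at hI
  rotate_left
  · exact (hi _).div_const _
  · exact (hi _).div_const _
  · exact ((hi _).div_const _).add ((hi _).div_const _)
  · exact (hi _).div_const _
  · exact (((hi _).div_const _).add ((hi _).div_const _)).add ((hi _).div_const _)
  · exact (hi _).div_const _
  · exact ((((hi _).div_const _).add ((hi _).div_const _)).add ((hi _).div_const _)).add
      ((hi _).div_const _)
  · exact (hi _).const_mul _
  have hπ : (π : ℂ) ≠ 0 := by exact_mod_cast Real.pi_ne_zero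
  have hr : (1 / (4 * π ^ 2) : ℂ) * (-2 * if -p = 0 then (4 * π ^ 2 : ℂ) else 0)
      = if p = 0 then -2 else 0 := by
    by_cases hp : p = 0
    · simp [hp]; field_simp
    · simp [hp]
  rw [hr] at hI
  rw [← hI]
  simp only [torusCoeff]
  ring

theorem continuous_phiB_sub_fFun (a₁ a₂ a₃ β ω : ℝ) :
    Continuous fun x : ℝ × ℝ => phiB a₃ β ω - fFun a₁ a₂ x.1 x.2 ω := by
  unfold fFun; fun_prop

/-- If `φ - f` is bounded away from zero and `(1 - μ) I = 1`, the Fourier coefficients of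
`1 / (φ - f)` solve the system (FD). -/
theorem exists_l2_solution {a₁ a₂ a₃ β μ ω d : ℝ} (hd : 0 < d)
    (hgap : ∀ x : ℝ × ℝ, d ≤ |phiB a₃ β ω - fFun a₁ a₂ x.1 x.2 ω|)
    (hI : (1 - μ) * IB a₁ a₂ a₃ β ω = 1) :
    ∃ u : ℤ × ℤ → ℂ, (Summable fun p : ℤ × ℤ => ‖u p‖ ^ 2) ∧ u ≠ 0 ∧
      SatisfiesFD a₁ a₂ a₃ β μ ω u := by
  set g : ℝ × ℝ → ℝ := fun x => (phiB a₃ β ω - fFun a₁ a₂ x.1 x.2 ω)⁻¹ with hgdef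
  have hne : ∀ x : ℝ × ℝ, phiB a₃ β ω - fFun a₁ a₂ x.1 x.2 ω ≠ 0 := fun x =>
    abs_pos.mp (hd.trans_le (hgap x))
  have hg : Continuous g := (continuous_phiB_sub_fFun a₁ a₂ a₃ β ω).inv₀ hne
  have hinv : ∀ x, g x * (phiB a₃ β ω - fFun a₁ a₂ x.1 x.2 ω) = 1 := fun x =>
    inv_mul_cancel₀ (hne x)
  have hbd : ∀ x, |g x| ≤ d⁻¹ := fun x => by
    rw [hgdef, abs_inv]; exact inv_anti₀ hd (hgap x)
  have hphi : (phiB a₃ β ω : ℂ) * torusCoeff g 0 = (IB a₁ a₂ a₃ β ω : ℂ) := by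
    have h1 : ∀ x, torusChar (-0) x * (g x : ℂ) = ((g x : ℝ) : ℂ) := by
      intro x; simp [torusChar]
    simp only [torusCoeff, h1, integral_complex_ofReal, IB, div_eq_mul_inv, integral_const_mul]
    push_cast
    ring
  have hcast : (1 - μ : ℂ) * (IB a₁ a₂ a₃ β ω : ℂ) = 1 := by exact_mod_cast hI
  refine ⟨torusCoeff g, summable_norm_sq_torusCoeff hg hbd, ?_, ?_, ?_⟩
  · intro h0
    rw [h0] at hphi
    rw [← hphi] at hcast
    simp at hcast
  · intro k l hkl
    have := torusCoeff_laplace hg hinv (k, l)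
    rw [if_neg (show (k, l) ≠ (0 : ℤ × ℤ) from hkl)] at this
    simpa using this
  · have := torusCoeff_laplace hg hinv (0, 0)
    have h2 : (2 * ((μ - 1 : ℝ) : ℂ) * (phiB a₃ β ω : ℂ) * torusCoeff g (0, 0)) = -2 := by
      have h0 : torusCoeff g (0, 0) = torusCoeff g 0 := rfl
      rw [h0, mul_assoc, hphi]
      push_cast
      linear_combination -2 * hcast
    rw [h2]
    rw [if_pos (show ((0 : ℤ), (0 : ℤ)) = 0 from rfl)] at this
    simpa using this

/-- The denominator `d + (1 - σ₁ cos ξ) B₁ + (1 - σ₂ cos η) B₂`. -/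
def cellDenom (σ₁ σ₂ d B₁ B₂ : ℝ) (x : ℝ × ℝ) : ℝ :=
  d + (1 - σ₁ * Real.cos x.1) * B₁ + (1 - σ₂ * Real.cos x.2) * B₂

theorem one_sub_mul_cos_nonneg {σ : ℝ} (hσ : σ = 1 ∨ σ = -1) (x : ℝ) :
    0 ≤ 1 - σ * Real.cos x := by
  rcases hσ with rfl | rfl <;> linarith [Real.neg_one_le_cos x, Real.cos_le_one x]

theorem one_sub_mul_cos_pos {σ : ℝ} (hσ : σ = 1 ∨ σ = -1) {x : ℝ}
    (hx : x ∈ Ioo (0 : ℝ) (2 * π)) (hxπ : x ≠ π) : 0 < 1 - σ * Real.cos x := by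
  have hsin : Real.sin x ≠ 0 := by
    rcases lt_or_gt_of_ne hxπ with h | h
    · exact (Real.sin_pos_of_pos_of_lt_pi hx.1 h).ne'
    · have := Real.sin_pos_of_pos_of_lt_pi (x := x - π) (by linarith) (by linarith [hx.2])
      rw [Real.sin_sub_pi] at this
      linarith
  have h2 := Real.sin_sq_add_cos_sq x
  have h3 : 0 < Real.sin x ^ 2 := by positivity
  rcases hσ with rfl | rfl <;> nlinarith [Real.neg_one_le_cos x, Real.cos_le_one x]

theorem exists_one_sub_mul_cos_le {σ : ℝ} (hσ : σ = 1 ∨ σ = -1) :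
    ∃ s ∈ Icc (0 : ℝ) π, ∀ x, 1 - σ * Real.cos x ≤ (x - s) ^ 2 / 2 := by
  rcases hσ with rfl | rfl
  · refine ⟨0, ⟨le_rfl, Real.pi_pos.le⟩, fun x => ?_⟩
    have := Real.one_sub_sq_div_two_le_cos (x := x)
    rw [sub_zero]; linarith
  · refine ⟨π, ⟨Real.pi_pos.le, le_rfl⟩, fun x => ?_⟩
    have := Real.one_sub_sq_div_two_le_cos (x := x - π)
    rw [Real.cos_sub_pi] at this
    linarith

theorem le_cellDenom {σ₁ σ₂ d B₁ B₂ : ℝ} (hσ₁ : σ₁ = 1 ∨ σ₁ = -1) (hσ₂ : σ₂ = 1 ∨ σ₂ = -1)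
    (hB₁ : 0 ≤ B₁) (hB₂ : 0 ≤ B₂) (x : ℝ × ℝ) : d ≤ cellDenom σ₁ σ₂ d B₁ B₂ x := by
  have h1 := mul_nonneg (one_sub_mul_cos_nonneg hσ₁ x.1) hB₁
  have h2 := mul_nonneg (one_sub_mul_cos_nonneg hσ₂ x.2) hB₂
  unfold cellDenom; linarith

theorem continuous_cellDenom (σ₁ σ₂ d B₁ B₂ : ℝ) : Continuous (cellDenom σ₁ σ₂ d B₁ B₂) := by
  unfold cellDenom; fun_prop

theorem continuous_inv_cellDenom {σ₁ σ₂ d B₁ B₂ : ℝ} (hσ₁ : σ₁ = 1 ∨ σ₁ = -1)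
    (hσ₂ : σ₂ = 1 ∨ σ₂ = -1) (hd : 0 < d) (hB₁ : 0 ≤ B₁) (hB₂ : 0 ≤ B₂) :
    Continuous fun x => (cellDenom σ₁ σ₂ d B₁ B₂ x)⁻¹ :=
  (continuous_cellDenom _ _ _ _ _).inv₀ fun x =>
    (hd.trans_le (le_cellDenom hσ₁ hσ₂ hB₁ hB₂ x)).ne'

theorem integral_inv_cellDenom_le {σ₁ σ₂ d d' B₁ B₂ : ℝ} (hσ₁ : σ₁ = 1 ∨ σ₁ = -1)
    (hσ₂ : σ₂ = 1 ∨ σ₂ = -1) (hd : 0 < d) (hB₁ : 0 ≤ B₁) (hB₂ : 0 ≤ B₂) (hdd' : d ≤ d') :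
    ∫ x in torusCell, (cellDenom σ₁ σ₂ d' B₁ B₂ x)⁻¹
      ≤ ∫ x in torusCell, (cellDenom σ₁ σ₂ d B₁ B₂ x)⁻¹ := by
  refine setIntegral_mono
    (continuous_inv_cellDenom hσ₁ hσ₂ (hd.trans_le hdd') hB₁ hB₂).integrableOn_torusCell
    (continuous_inv_cellDenom hσ₁ hσ₂ hd hB₁ hB₂).integrableOn_torusCell fun x => ?_
  refine inv_anti₀ (hd.trans_le (le_cellDenom hσ₁ hσ₂ hB₁ hB₂ x)) ?_
  simp only [cellDenom]; linarith

theorem integral_inv_cellDenom_le_const {σ₁ σ₂ d B₁ B₂ : ℝ} (hσ₁ : σ₁ = 1 ∨ σ₁ = -1)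
    (hσ₂ : σ₂ = 1 ∨ σ₂ = -1) (hd : 0 < d) (hB₁ : 0 ≤ B₁) (hB₂ : 0 ≤ B₂) :
    ∫ x in torusCell, (cellDenom σ₁ σ₂ d B₁ B₂ x)⁻¹ ≤ 4 * π ^ 2 * d⁻¹ := by
  have h := setIntegral_mono
    (continuous_inv_cellDenom hσ₁ hσ₂ hd hB₁ hB₂).integrableOn_torusCell
    (continuous_const (y := d⁻¹)).integrableOn_torusCell
    fun x => inv_anti₀ hd (le_cellDenom hσ₁ hσ₂ hB₁ hB₂ x)
  rwa [setIntegral_const, volume_real_torusCell, smul_eq_mul] at h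

theorem ae_torusCell_pos {σ₁ σ₂ : ℝ} (hσ₁ : σ₁ = 1 ∨ σ₁ = -1) (hσ₂ : σ₂ = 1 ∨ σ₂ = -1) :
    ∀ᵐ x ∂(volume : Measure (ℝ × ℝ)).restrict torusCell,
      0 < min (1 - σ₁ * Real.cos x.1) (1 - σ₂ * Real.cos x.2) := by
  have h1 : ∀ᵐ x : ℝ × ℝ, x.1 ≠ π := by
    rw [ae_iff]
    have : {x : ℝ × ℝ | ¬ x.1 ≠ π} = {π} ×ˢ univ := by ext x; simp
    rw [this, Measure.volume_eq_prod, Measure.prod_prod]; simp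
  have h2 : ∀ᵐ x : ℝ × ℝ, x.2 ≠ π := by
    rw [ae_iff]
    have : {x : ℝ × ℝ | ¬ x.2 ≠ π} = univ ×ˢ {π} := by ext x; simp
    rw [this, Measure.volume_eq_prod, Measure.prod_prod]; simp
  filter_upwards [ae_restrict_of_ae h1, ae_restrict_of_ae h2,
    ae_restrict_mem measurableSet_torusCell] with x h1 h2 hx
  exact lt_min (one_sub_mul_cos_pos hσ₁ hx.1 h1) (one_sub_mul_cos_pos hσ₂ hx.2 h2)

/-- The mean of `1 / cellDenom` tends to zero as `B₁ + B₂ → ∞`. -/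
theorem exists_integral_inv_cellDenom_le {σ₁ σ₂ d ε : ℝ} (hσ₁ : σ₁ = 1 ∨ σ₁ = -1)
    (hσ₂ : σ₂ = 1 ∨ σ₂ = -1) (hd : 0 < d) (hε : 0 < ε) :
    ∃ b : ℝ, ∀ B₁ B₂ : ℝ, 0 ≤ B₁ → 0 ≤ B₂ → b ≤ B₁ + B₂ →
      ∫ x in torusCell, (cellDenom σ₁ σ₂ d B₁ B₂ x)⁻¹ ≤ ε := by
  set m : ℝ × ℝ → ℝ := fun x => min (1 - σ₁ * Real.cos x.1) (1 - σ₂ * Real.cos x.2) with hm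
  have hmc : Continuous m := by rw [hm]; fun_prop
  have hm0 : ∀ x, 0 ≤ m x := fun x =>
    le_min (one_sub_mul_cos_nonneg hσ₁ x.1) (one_sub_mul_cos_nonneg hσ₂ x.2)
  have hdm : ∀ (n : ℕ) (x : ℝ × ℝ), d ≤ d + n * m x := fun n x => by
    have := mul_nonneg (Nat.cast_nonneg (α := ℝ) n) (hm0 x)
    linarith
  have hc : ∀ n : ℕ, Continuous fun x => (d + n * m x)⁻¹ := fun n =>
    (by fun_prop : Continuous fun x => d + n * m x).inv₀ fun x => (hd.trans_le (hdm n x)).ne'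
  have hlim := tendsto_integral_of_dominated_convergence
    (μ := (volume : Measure (ℝ × ℝ)).restrict torusCell)
    (F := fun (n : ℕ) x => (d + n * m x)⁻¹) (f := fun _ => (0 : ℝ)) (fun _ => d⁻¹)
    (fun n => (hc n).aestronglyMeasurable) (integrable_const _)
    (fun n => ae_of_all _ fun x => by
      rw [Real.norm_of_nonneg (inv_nonneg.mpr (hd.le.trans (hdm n x)))]
      exact inv_anti₀ hd (hdm n x))
    (by
      filter_upwards [ae_torusCell_pos hσ₁ hσ₂] with x hx
      refine tendsto_inv_atTop_zero.comp (tendsto_atTop_add_const_left _ _ ?_)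
      exact tendsto_natCast_atTop_atTop.atTop_mul_const hx)
  rw [integral_zero] at hlim
  obtain ⟨N, hN⟩ := (hlim.eventually (gt_mem_nhds hε)).exists
  refine ⟨N, fun B₁ B₂ hB₁ hB₂ hB => le_trans ?_ hN.le⟩
  refine setIntegral_mono (continuous_inv_cellDenom hσ₁ hσ₂ hd hB₁ hB₂).integrableOn_torusCell
    (hc N).integrableOn_torusCell fun x => inv_anti₀ (hd.trans_le (hdm N x)) ?_
  have h1 : m x * B₁ ≤ (1 - σ₁ * Real.cos x.1) * B₁ :=
    mul_le_mul_of_nonneg_right (min_le_left _ _) hB₁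
  have h2 : m x * B₂ ≤ (1 - σ₂ * Real.cos x.2) * B₂ :=
    mul_le_mul_of_nonneg_right (min_le_right _ _) hB₂
  have h3 := mul_le_mul_of_nonneg_left hB (hm0 x)
  unfold cellDenom
  linarith

theorem integral_div_add_mul_sq {d C : ℝ} (hd : 0 < d) (hC : 0 < C) (s : ℝ) :
    ∫ x in s..(s + 1), (x - s) * (d + C * (x - s) ^ 2)⁻¹
      = (2 * C)⁻¹ * (Real.log (d + C) - Real.log d) := by
  have hpos : ∀ x : ℝ, 0 < d + C * (x - s) ^ 2 := fun x => by positivity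
  have hder : ∀ x ∈ uIcc s (s + 1), HasDerivAt
      (fun x => (2 * C)⁻¹ * Real.log (d + C * (x - s) ^ 2))
      ((x - s) * (d + C * (x - s) ^ 2)⁻¹) x := by
    intro x _
    have h1 : HasDerivAt (fun x : ℝ => d + C * (x - s) ^ 2) (C * (2 * (x - s))) x := by
      have := ((((hasDerivAt_id x).sub_const s).pow 2).const_mul C).const_add d
      simpa using this
    have h2 := (h1.log (hpos x).ne').const_mul (2 * C)⁻¹
    refine h2.congr_deriv ?_
    have := (hpos x).ne'
    field_simp
  rw [intervalIntegral.integral_eq_sub_of_hasDerivAt hder]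
  · simp
    ring
  · refine Continuous.intervalIntegrable ?_ _ _
    exact (by fun_prop : Continuous fun x : ℝ => x - s).mul
      ((by fun_prop : Continuous fun x : ℝ => d + C * (x - s) ^ 2).inv₀ fun x => (hpos x).ne')

theorem log_le_integral_inv_cellDenom {σ₁ σ₂ d C : ℝ} (hσ₁ : σ₁ = 1 ∨ σ₁ = -1)
    (hσ₂ : σ₂ = 1 ∨ σ₂ = -1) (hd : 0 < d) (hC : 0 < C) :
    (2 * C)⁻¹ * (Real.log (d + C) - Real.log d)
      ≤ ∫ x in torusCell, (cellDenom σ₁ σ₂ d C C x)⁻¹ := by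
  obtain ⟨s, hs, hs'⟩ := exists_one_sub_mul_cos_le hσ₁
  obtain ⟨r, hr, hr'⟩ := exists_one_sub_mul_cos_le hσ₂
  have hπ := Real.pi_gt_three
  set h : ℝ × ℝ → ℝ := fun x => (cellDenom σ₁ σ₂ d C C x)⁻¹ with hh
  have hc : Continuous h := continuous_inv_cellDenom hσ₁ hσ₂ hd hC.le hC.le
  have hpos : ∀ x, 0 < cellDenom σ₁ σ₂ d C C x := fun x =>
    hd.trans_le (le_cellDenom hσ₁ hσ₂ hC.le hC.le x)
  have h0 : ∀ x, 0 ≤ h x := fun x => (inv_pos.mpr (hpos x)).le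
  have hsub : Ioo s (s + 1) ×ˢ Ioo r (r + 1) ⊆ torusCell :=
    prod_mono (Ioo_subset_Ioo hs.1 (by linarith [hs.2])) (Ioo_subset_Ioo hr.1 (by linarith [hr.2]))
  have hint := hc.integrableOn_torusCell
  have hint' : IntegrableOn h (Ioo s (s + 1) ×ˢ Ioo r (r + 1)) := hint.mono_set hsub
  have step1 : ∫ x in Ioo s (s + 1) ×ˢ Ioo r (r + 1), h x ≤ ∫ x in torusCell, h x :=
    setIntegral_mono_set hint (ae_of_all _ h0) hsub.eventuallyLE
  refine le_trans ?_ step1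
  rw [Measure.volume_eq_prod] at hint' ⊢
  rw [setIntegral_prod _ hint', ← integral_div_add_mul_sq hd hC s,
    intervalIntegral.integral_of_le (by linarith), integral_Ioc_eq_integral_Ioo]
  have hcont : Continuous fun x : ℝ => (x - s) * (d + C * (x - s) ^ 2)⁻¹ :=
    (by fun_prop : Continuous fun x : ℝ => x - s).mul
      ((by fun_prop : Continuous fun x : ℝ => d + C * (x - s) ^ 2).inv₀
        fun x => (by positivity : 0 < d + C * (x - s) ^ 2).ne')
  refine setIntegral_mono_on
    ((hcont.continuousOn.integrableOn_compact isCompact_Icc).mono_set Ioo_subset_Icc_self) ?_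
    measurableSet_Ioo fun x hx => ?_
  · rw [IntegrableOn, ← Measure.prod_restrict] at hint'
    exact hint'.integral_prod_left
  · have hxs : 0 < x - s := by linarith [hx.1]
    have hcx : Continuous fun y => h (x, y) := by fun_prop
    have hi : IntegrableOn (fun y => h (x, y)) (Ioo r (r + 1)) :=
      (hcx.continuousOn.integrableOn_compact isCompact_Icc).mono_set Ioo_subset_Icc_self
    have hsub' : Ioo r (r + (x - s)) ⊆ Ioo r (r + 1) :=
      Ioo_subset_Ioo le_rfl (by linarith [hx.2])
    refine le_trans ?_ (setIntegral_mono_set hi (ae_of_all _ fun y => h0 (x, y))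
      hsub'.eventuallyLE)
    have hm := setIntegral_mono_on (f := fun _ : ℝ => (d + C * (x - s) ^ 2)⁻¹)
      (g := fun y => h (x, y)) (μ := volume) (s := Ioo r (r + (x - s)))
      (by simp) (hi.mono_set hsub')
      measurableSet_Ioo fun y hy => by
        refine inv_anti₀ (hpos _) ?_
        have e1 := mul_le_mul_of_nonneg_right (hs' x) hC.le
        have e2 := mul_le_mul_of_nonneg_right (hr' y) hC.le
        have e3 : (y - r) ^ 2 ≤ (x - s) ^ 2 :=
          pow_le_pow_left₀ (by linarith [hy.1]) (by linarith [hy.2]) 2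
        have e4 := mul_le_mul_of_nonneg_right e3 hC.le
        simp only [cellDenom]
        linarith
    rw [setIntegral_const, Real.volume_real_Ioo_of_le (by linarith), smul_eq_mul] at hm
    simpa using hm

/-- The integral of `1 / cellDenom` diverges logarithmically as `d → 0`. -/
theorem exists_le_integral_inv_cellDenom {σ₁ σ₂ C : ℝ} (hσ₁ : σ₁ = 1 ∨ σ₁ = -1)
    (hσ₂ : σ₂ = 1 ∨ σ₂ = -1) (hC : 0 < C) (K : ℝ) :
    ∃ d₀ > 0, ∀ d, 0 < d → d ≤ d₀ → ∀ B₁ B₂, 0 ≤ B₁ → B₁ ≤ C → 0 ≤ B₂ → B₂ ≤ C →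
      K ≤ ∫ x in torusCell, (cellDenom σ₁ σ₂ d B₁ B₂ x)⁻¹ := by
  refine ⟨C * Real.exp (-(2 * C * K)), by positivity, fun d hd hdle B₁ B₂ hB₁ hB₁C hB₂ hB₂C => ?_⟩
  have h1 : Real.log d ≤ Real.log C - 2 * C * K := by
    have := Real.log_le_log hd hdle
    rwa [Real.log_mul hC.ne' (Real.exp_ne_zero _), Real.log_exp, ← sub_eq_add_neg] at this
  have h2 : Real.log C ≤ Real.log (d + C) := Real.log_le_log hC (by linarith)
  have h3 : K ≤ (2 * C)⁻¹ * (Real.log (d + C) - Real.log d) := by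
    rw [inv_mul_eq_div, le_div_iff₀ (by positivity)]
    linarith
  refine h3.trans ((log_le_integral_inv_cellDenom hσ₁ hσ₂ hd hC).trans ?_)
  refine setIntegral_mono (continuous_inv_cellDenom hσ₁ hσ₂ hd hC.le hC.le).integrableOn_torusCell
    (continuous_inv_cellDenom hσ₁ hσ₂ hd hB₁ hB₂).integrableOn_torusCell fun x => ?_
  refine inv_anti₀ (hd.trans_le (le_cellDenom hσ₁ hσ₂ hB₁ hB₂ x)) ?_
  have e1 := mul_le_mul_of_nonneg_left hB₁C (one_sub_mul_cos_nonneg hσ₁ x.1)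
  have e2 := mul_le_mul_of_nonneg_left hB₂C (one_sub_mul_cos_nonneg hσ₂ x.2)
  unfold cellDenom
  linarith

/-- For `t = tan (y / 2)`, the coefficient `1 / sin y = (1 + t²) / (2 t)`. -/
def cosecHalf (t : ℝ) : ℝ := (1 + t ^ 2) / (2 * t)

theorem cosecHalf_nonneg {t : ℝ} (ht : 0 < t) : 0 ≤ cosecHalf t := by
  unfold cosecHalf; positivity

theorem cosecHalf_le {t r s : ℝ} (hr : 0 < r) (hrt : r ≤ t) (hts : t ≤ s) :
    cosecHalf t ≤ (1 + s ^ 2) / (2 * r) := by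
  unfold cosecHalf
  have : 0 < t := hr.trans_le hrt
  gcongr

theorem le_cosecHalf {t b : ℝ} (ht : 0 < t) (htb : t < (2 * (|b| + 1))⁻¹) : b ≤ cosecHalf t := by
  have h0 : 0 < |b| + 1 := by positivity
  have h1 : t * (2 * (|b| + 1)) < 1 := by
    rwa [lt_inv_comm₀ ht (by positivity), lt_inv_comm₀ (by positivity) ht,
      ← one_div, lt_div_iff₀ (by positivity)] at htb
  unfold cosecHalf
  rw [le_div_iff₀ (by positivity)]
  nlinarith [le_abs_self b, sq_nonneg t]

theorem ContinuousOn.exists_lt_of_left_eq_zero {t : ℝ → ℝ} {a b c η : ℝ}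
    (ht : ContinuousOn t (Icc a b)) (ht0 : t a = 0) (hac : a < c) (hcb : c ≤ b) (hη : 0 < η) :
    ∃ ω ∈ Ioo a c, t ω < η := by
  have h1 : ContinuousWithinAt t (Ioo a c) a :=
    (ht a ⟨le_rfl, hac.le.trans hcb⟩).mono fun x hx => ⟨hx.1.le, hx.2.le.trans hcb⟩
  have h2 : Tendsto t (𝓝[>] a) (𝓝 (t a)) := by
    rw [← nhdsWithin_Ioo_eq_nhdsGT hac]; exact h1
  rw [ht0] at h2
  obtain ⟨ω, h3, h4⟩ := ((h2.eventually (gt_mem_nhds hη)).and (Ioo_mem_nhdsGT hac)).exists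
  exact ⟨ω, h4, h3⟩

/-- Intermediate value argument: the mean of `P / (P - t₁ - t₂ + …)` is small near the left end,
where some `tᵢ` vanishes, and blows up at the right end, where `P = t₁ + t₂`. -/
theorem exists_mean_eq {ωb ωt L σ₁ σ₂ : ℝ} {P t₁ t₂ : ℝ → ℝ} (hlt : ωb < ωt) (hL : 1 < L)
    (hσ₁ : σ₁ = 1 ∨ σ₁ = -1) (hσ₂ : σ₂ = 1 ∨ σ₂ = -1)
    (hPc : ContinuousOn P (Ioc ωb ωt)) (hPa : AntitoneOn P (Ioc ωb ωt))
    (h1c : ContinuousOn t₁ (Icc ωb ωt)) (h1m : MonotoneOn t₁ (Icc ωb ωt))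
    (h1p : ∀ ω ∈ Ioc ωb ωt, 0 < t₁ ω)
    (h2c : ContinuousOn t₂ (Icc ωb ωt)) (h2m : MonotoneOn t₂ (Icc ωb ωt))
    (h2p : ∀ ω ∈ Ioc ωb ωt, 0 < t₂ ω)
    (hb : t₁ ωb = 0 ∨ t₂ ωb = 0)
    (hδ : ∀ ω ∈ Ioo ωb ωt, t₁ ω + t₂ ω < P ω) (hδt : P ωt = t₁ ωt + t₂ ωt) :
    ∃ ω ∈ Ioo ωb ωt, 1 / (4 * π ^ 2) * (P ω * ∫ x in torusCell,
      (cellDenom σ₁ σ₂ (P ω - t₁ ω - t₂ ω) (cosecHalf (t₁ ω)) (cosecHalf (t₂ ω)) x)⁻¹) = L := by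
  set J : ℝ → ℝ := fun ω => ∫ x in torusCell,
      (cellDenom σ₁ σ₂ (P ω - t₁ ω - t₂ ω) (cosecHalf (t₁ ω)) (cosecHalf (t₂ ω)) x)⁻¹ with hJ
  have hπ : 0 < 4 * π ^ 2 := by positivity
  have htmem : ωt ∈ Ioc ωb ωt := ⟨hlt, le_rfl⟩
  have hIoo : Ioo ωb ωt ⊆ Ioc ωb ωt := Ioo_subset_Ioc_self
  have hIoc : Ioc ωb ωt ⊆ Icc ωb ωt := Ioc_subset_Icc_self
  have hB1 : ∀ ω ∈ Ioc ωb ωt, 0 ≤ cosecHalf (t₁ ω) := fun ω h => cosecHalf_nonneg (h1p ω h)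
  have hB2 : ∀ ω ∈ Ioc ωb ωt, 0 ≤ cosecHalf (t₂ ω) := fun ω h => cosecHalf_nonneg (h2p ω h)
  have hδp : ∀ ω ∈ Ioo ωb ωt, 0 < P ω - t₁ ω - t₂ ω := fun ω h => by linarith [hδ ω h]
  have hPp : ∀ ω ∈ Ioo ωb ωt, 0 < P ω := fun ω h => by
    linarith [hδ ω h, h1p ω (hIoo h), h2p ω (hIoo h)]
  have hδa : ∀ ω ∈ Ioc ωb ωt, ∀ ω' ∈ Ioc ωb ωt, ω ≤ ω' →
      P ω' - t₁ ω' - t₂ ω' ≤ P ω - t₁ ω - t₂ ω := fun ω h ω' h' hle => by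
    linarith [hPa h h' hle, h1m (hIoc h) (hIoc h') hle, h2m (hIoc h) (hIoc h') hle]
  have hJ0 : ∀ ω ∈ Ioo ωb ωt, 0 ≤ J ω := fun ω h =>
    integral_nonneg fun x => inv_nonneg.mpr ((hδp ω h).le.trans
      (le_cellDenom hσ₁ hσ₂ (hB1 ω (hIoo h)) (hB2 ω (hIoo h)) x))
  obtain ⟨ωm, hbm, hmt⟩ := exists_between hlt
  have hm : ωm ∈ Ioo ωb ωt := ⟨hbm, hmt⟩
  have hlow : ∃ ω ∈ Ioo ωb ωt, 1 / (4 * π ^ 2) * (P ω * J ω) < L := by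
    by_cases hbdd : ∃ M, ∀ ω ∈ Ioo ωb ωt, P ω ≤ M
    · obtain ⟨M, hM⟩ := hbdd
      have hM0 : 0 < M := (hPp ωm hm).trans_le (hM ωm hm)
      obtain ⟨b, hbb⟩ := exists_integral_inv_cellDenom_le (ε := 4 * π ^ 2 / M) hσ₁ hσ₂ (hδp ωm hm)
        (by positivity)
      have hη : 0 < (2 * (|b| + 1))⁻¹ := by positivity
      have hω : ∃ ω ∈ Ioo ωb ωm, b ≤ cosecHalf (t₁ ω) + cosecHalf (t₂ ω) := by
        have hmem : ∀ ω ∈ Ioo ωb ωm, ω ∈ Ioc ωb ωt := fun ω h => ⟨h.1, (h.2.trans hmt).le⟩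
        rcases hb with hb | hb
        · obtain ⟨ω, h, hlt'⟩ := h1c.exists_lt_of_left_eq_zero hb hbm hmt.le hη
          exact ⟨ω, h, by linarith [le_cosecHalf (h1p ω (hmem ω h)) hlt', hB2 ω (hmem ω h)]⟩
        · obtain ⟨ω, h, hlt'⟩ := h2c.exists_lt_of_left_eq_zero hb hbm hmt.le hη
          exact ⟨ω, h, by linarith [le_cosecHalf (h2p ω (hmem ω h)) hlt', hB1 ω (hmem ω h)]⟩
      obtain ⟨ω, hω, hωb⟩ := hω
      have hω' : ω ∈ Ioo ωb ωt := ⟨hω.1, hω.2.trans hmt⟩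
      refine ⟨ω, hω', lt_of_le_of_lt ?_ hL⟩
      have hJle : J ω ≤ 4 * π ^ 2 / M :=
        (integral_inv_cellDenom_le hσ₁ hσ₂ (hδp ωm hm) (hB1 ω (hIoo hω')) (hB2 ω (hIoo hω'))
          (hδa ω (hIoo hω') ωm (hIoo hm) hω.2.le)).trans
          (hbb _ _ (hB1 ω (hIoo hω')) (hB2 ω (hIoo hω')) hωb)
      have : P ω * J ω ≤ M * (4 * π ^ 2 / M) :=
        mul_le_mul (hM ω hω') hJle (hJ0 ω hω') hM0.le
      rw [mul_div_cancel₀ _ hM0.ne'] at this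
      rw [one_div, inv_mul_le_iff₀ hπ, mul_one]
      exact this
    · push Not at hbdd
      have hS : 0 < t₁ ωt + t₂ ωt := add_pos (h1p ωt htmem) (h2p ωt htmem)
      obtain ⟨ω, hω, hωP⟩ := hbdd ((t₁ ωt + t₂ ωt) * L / (L - 1))
      refine ⟨ω, hω, ?_⟩
      rw [div_lt_iff₀ (by linarith)] at hωP
      have hJle : J ω ≤ 4 * π ^ 2 * (P ω - t₁ ω - t₂ ω)⁻¹ :=
        integral_inv_cellDenom_le_const hσ₁ hσ₂ (hδp ω hω) (hB1 ω (hIoo hω)) (hB2 ω (hIoo hω))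
      have e1 := h1m (hIoc (hIoo hω)) (hIoc htmem) hω.2.le
      have e2 := h2m (hIoc (hIoo hω)) (hIoc htmem) hω.2.le
      have hPlt : P ω < L * (P ω - t₁ ω - t₂ ω) := by nlinarith
      have hdiv : P ω * (P ω - t₁ ω - t₂ ω)⁻¹ < L := by
        rwa [← div_eq_mul_inv, div_lt_iff₀ (hδp ω hω)]
      calc 1 / (4 * π ^ 2) * (P ω * J ω)
          ≤ 1 / (4 * π ^ 2) * (P ω * (4 * π ^ 2 * (P ω - t₁ ω - t₂ ω)⁻¹)) := by
            have := (hPp ω hω).le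
            gcongr
        _ = P ω * (P ω - t₁ ω - t₂ ω)⁻¹ := by
            field_simp
        _ < L := hdiv
  have hhigh : ∃ ω ∈ Ioo ωb ωt, L ≤ 1 / (4 * π ^ 2) * (P ω * J ω) := by
    have hPt : 0 < P ωt := by rw [hδt]; exact add_pos (h1p ωt htmem) (h2p ωt htmem)
    have hmp1 := h1p ωm (hIoo hm)
    have hmp2 := h2p ωm (hIoo hm)
    set C := max ((1 + t₁ ωt ^ 2) / (2 * t₁ ωm)) ((1 + t₂ ωt ^ 2) / (2 * t₂ ωm)) with hC
    have hC0 : 0 < C := lt_max_of_lt_left (by positivity)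
    obtain ⟨d₀, hd₀, hd₀'⟩ := exists_le_integral_inv_cellDenom hσ₁ hσ₂ hC0
      (L * (4 * π ^ 2) / P ωt)
    have hcont : ContinuousWithinAt (fun ω => P ω - t₁ ω - t₂ ω) (Ioo ωm ωt) ωt :=
      (((hPc ωt htmem).sub ((h1c ωt (hIoc htmem)).mono hIoc)).sub
        ((h2c ωt (hIoc htmem)).mono hIoc)).mono fun x hx => ⟨hbm.trans hx.1, hx.2.le⟩
    have hT : Tendsto (fun ω => P ω - t₁ ω - t₂ ω) (𝓝[<] ωt) (𝓝 0) := by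
      rw [← nhdsWithin_Ioo_eq_nhdsLT hmt]
      have : P ωt - t₁ ωt - t₂ ωt = 0 := by linarith
      rw [← this]; exact hcont
    obtain ⟨ω, h3, h4⟩ := ((hT.eventually (gt_mem_nhds hd₀)).and (Ioo_mem_nhdsLT hmt)).exists
    have hω : ω ∈ Ioo ωb ωt := ⟨hbm.trans h4.1, h4.2⟩
    refine ⟨ω, hω, ?_⟩
    have hω' := hIoo hω
    have hω'' := hIoc hω'
    have hm'' := hIoc (hIoo hm)
    have hJge : L * (4 * π ^ 2) / P ωt ≤ J ω :=
      hd₀' _ (hδp ω hω) h3.le _ _ (hB1 ω hω')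
        ((cosecHalf_le hmp1 (h1m hm'' hω'' h4.1.le) (h1m hω'' (hIoc htmem) h4.2.le)).trans
          (le_max_left _ _)) (hB2 ω hω')
        ((cosecHalf_le hmp2 (h2m hm'' hω'' h4.1.le) (h2m hω'' (hIoc htmem) h4.2.le)).trans
          (le_max_right _ _))
    have hPle : P ωt ≤ P ω := hPa hω' htmem h4.2.le
    have hmul : P ωt * (L * (4 * π ^ 2) / P ωt) ≤ P ω * J ω :=
      mul_le_mul hPle hJge (by positivity) (hPp ω hω).le
    rw [mul_div_cancel₀ _ hPt.ne'] at hmul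
    rw [one_div, le_inv_mul_iff₀ hπ]
    linarith
  obtain ⟨u, hu, hul⟩ := hlow
  obtain ⟨v, hv, hvl⟩ := hhigh
  have hsub : uIcc u v ⊆ Ioo ωb ωt := ordConnected_Ioo.uIcc_subset hu hv
  have hmax : max u v ∈ Ioo ωb ωt := ⟨lt_max_of_lt_left hu.1, max_lt hu.2 hv.2⟩
  have hJc : ContinuousOn J (uIcc u v) := by
    refine continuousOn_of_dominated (bound := fun _ => (P (max u v) - t₁ (max u v)
      - t₂ (max u v))⁻¹) (fun ω hω => ?_) (fun ω hω => ae_of_all _ fun x => ?_)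
      (integrable_const _) (ae_of_all _ fun x => ?_)
    · have h := hsub hω
      exact (continuous_inv_cellDenom hσ₁ hσ₂ (hδp ω h) (hB1 ω (hIoo h))
        (hB2 ω (hIoo h))).aestronglyMeasurable
    · have h := hsub hω
      have hle := le_cellDenom hσ₁ hσ₂ (d := P ω - t₁ ω - t₂ ω) (hB1 ω (hIoo h)) (hB2 ω (hIoo h)) x
      rw [Real.norm_of_nonneg (inv_nonneg.mpr ((hδp ω h).le.trans hle))]
      exact inv_anti₀ (hδp _ hmax) ((hδa ω (hIoo h) _ (hIoo hmax) hω.2).trans hle)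
    · have hs : uIcc u v ⊆ Ioc ωb ωt := hsub.trans hIoo
      have c1 := h1c.mono (hs.trans hIoc)
      have c2 := h2c.mono (hs.trans hIoc)
      have c3 := hPc.mono hs
      have hh : ∀ t : ℝ → ℝ, ContinuousOn t (uIcc u v) → (∀ ω ∈ uIcc u v, 0 < t ω) →
          ContinuousOn (fun ω => cosecHalf (t ω)) (uIcc u v) := fun t ht htp =>
        ((ht.pow 2).const_add 1).div (ht.const_mul 2) fun ω hω =>
          (mul_pos two_pos (htp ω hω)).ne'
      have b1 := hh t₁ c1 fun ω hω => h1p ω (hs hω)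
      have b2 := hh t₂ c2 fun ω hω => h2p ω (hs hω)
      refine ContinuousOn.inv₀ ?_ fun ω hω => ((hδp ω (hsub hω)).trans_le
        (le_cellDenom hσ₁ hσ₂ (hB1 ω (hs hω)) (hB2 ω (hs hω)) x)).ne'
      exact (((c3.sub c1).sub c2).add (b1.const_mul _)).add (b2.const_mul _)
  have hc : ContinuousOn (fun ω => 1 / (4 * π ^ 2) * (P ω * J ω)) (uIcc u v) :=
    ((hPc.mono (hsub.trans hIoo)).mul hJc).const_mul _
  obtain ⟨ω, hω, hωL⟩ := intermediate_value_uIcc hc (mem_uIcc_of_le hul.le hvl)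
  exact ⟨ω, hsub hω, hωL⟩

/-- The half-angle tangent on the branch `ω a ∈ [mπ, (m + 1)π)`. -/
def halfTan (a : ℝ) (m : ℤ) (ω : ℝ) : ℝ := Real.tan ((ω * a - m * π) / 2)

/-- The function `φ_β` expressed in the half-angle tangent `t`, with `c = ± cos β`. -/
def phiHalf (c t : ℝ) : ℝ := (1 - c) / (2 * t) - (1 + c) * t / 2

theorem neg_one_zpow_eq_one_or (m : ℤ) : ((-1 : ℝ) ^ m = 1) ∨ ((-1 : ℝ) ^ m = -1) := by
  rcases Int.even_or_odd m with h | h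
  · exact Or.inl h.neg_one_zpow
  · exact Or.inr h.neg_one_zpow

theorem halfTan_pos {a ω : ℝ} {m : ℤ} (h : ω * a - m * π ∈ Ioo 0 π) : 0 < halfTan a m ω :=
  Real.tan_pos_of_pos_of_lt_pi_div_two (by linarith [h.1]) (by linarith [h.2])

theorem strictMonoOn_halfTan {a : ℝ} (ha : 0 < a) (m : ℤ) :
    StrictMonoOn (halfTan a m) {ω | ω * a - m * π ∈ Ico 0 π} := by
  intro x hx y hy hxy
  have hxa := mul_lt_mul_of_pos_right hxy ha
  exact Real.tan_lt_tan_of_lt_of_lt_pi_div_two (by linarith [hx.1, Real.pi_pos])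
    (by linarith [hy.2]) (by linarith)

theorem continuousOn_halfTan (a : ℝ) (m : ℤ) :
    ContinuousOn (halfTan a m) {ω | ω * a - m * π ∈ Ico 0 π} := by
  refine Real.continuousOn_tan_Ioo.comp (by fun_prop) fun x hx => ?_
  exact ⟨by linarith [hx.1, Real.pi_pos], by linarith [hx.2]⟩

theorem sin_cos_eq_halfTan {a ω : ℝ} {m : ℤ} (h : ω * a - m * π ∈ Ioo 0 π) :
    Real.sin (ω * a) = (-1) ^ m * (2 * halfTan a m ω / (1 + halfTan a m ω ^ 2)) ∧
    Real.cos (ω * a) = (-1) ^ m * ((1 - halfTan a m ω ^ 2) / (1 + halfTan a m ω ^ 2)) := by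
  set y := (ω * a - m * π) / 2 with hy
  have hx : ω * a = 2 * y + m * π := by rw [hy]; ring
  have hc : 0 < Real.cos y :=
    Real.cos_pos_of_mem_Ioo ⟨by linarith [h.1, Real.pi_pos], by linarith [h.2]⟩
  have hsc := Real.sin_sq_add_cos_sq y
  have ht : halfTan a m ω = Real.sin y / Real.cos y := Real.tan_eq_sin_div_cos y
  have hd : 1 + (Real.sin y / Real.cos y) ^ 2 = 1 / Real.cos y ^ 2 := by
    field_simp; linarith
  rw [hx, Real.sin_add_int_mul_pi, Real.cos_add_int_mul_pi, Real.sin_two_mul, Real.cos_two_mul,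
    ht, hd]
  constructor <;> congr 1 <;> field_simp
  linarith

theorem mem_branch {a ωb ωt ω : ℝ} (ha : 0 < a) (hgap : ∀ ω ∈ Ioc ωb ωt, Real.sin (ω * a) ≠ 0)
    (hω : ω ∈ Ioc ωb ωt) : ω * a - ⌊ωb * a / π⌋ * π ∈ Ioo 0 π := by
  have h1 := Int.floor_le (ωb * a / π)
  have h2 := Int.lt_floor_add_one (ωb * a / π)
  rw [le_div_iff₀ Real.pi_pos] at h1
  rw [div_lt_iff₀ Real.pi_pos] at h2
  have h3 := mul_lt_mul_of_pos_right hω.1 ha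
  refine ⟨by linarith, ?_⟩
  by_contra hcon
  push Not at hcon
  refine hgap ((⌊ωb * a / π⌋ + 1) * π / a) ⟨?_, ?_⟩ ?_
  · rwa [lt_div_iff₀ ha]
  · rw [div_le_iff₀ ha]
    have := mul_le_mul_of_nonneg_right hω.2 ha.le
    linarith
  · rw [div_mul_cancel₀ _ ha.ne']
    exact_mod_cast Real.sin_int_mul_pi (⌊ωb * a / π⌋ + 1)

theorem left_mem_branch (a ωb : ℝ) : ωb * a - ⌊ωb * a / π⌋ * π ∈ Ico 0 π := by
  have h1 := Int.floor_le (ωb * a / π)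
  have h2 := Int.lt_floor_add_one (ωb * a / π)
  rw [le_div_iff₀ Real.pi_pos] at h1
  rw [div_lt_iff₀ Real.pi_pos] at h2
  constructor <;> linarith

theorem halfTan_floor_eq_zero {a ωb : ℝ} (h : Real.sin (ωb * a) = 0) :
    halfTan a ⌊ωb * a / π⌋ ωb = 0 := by
  obtain ⟨n, hn⟩ := Real.sin_eq_zero_iff.mp h
  rw [halfTan, ← hn, mul_div_cancel_right₀ _ Real.pi_ne_zero, Int.floor_intCast]
  simp

theorem phiB_eq_phiHalf {a₃ β ω : ℝ} {m : ℤ} (h : ω * a₃ - m * π ∈ Ioo 0 π) :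
    phiB a₃ β ω = phiHalf ((-1) ^ m * Real.cos β) (halfTan a₃ m ω) := by
  obtain ⟨hs, hc⟩ := sin_cos_eq_halfTan h
  have ht := halfTan_pos h
  rw [phiB, phiHalf, hs, hc]
  generalize halfTan a₃ m ω = t at ht ⊢
  have h1 : 0 < 1 + t ^ 2 := by positivity
  rcases neg_one_zpow_eq_one_or m with h | h <;> rw [h] <;> field_simp <;> ring

theorem phiHalf_sub_fFun {a₁ a₂ ω : ℝ} {m₁ m₂ : ℤ} (h1 : ω * a₁ - m₁ * π ∈ Ioo 0 π)
    (h2 : ω * a₂ - m₂ * π ∈ Ioo 0 π) (P : ℝ) (x : ℝ × ℝ) :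
    P - fFun a₁ a₂ x.1 x.2 ω = cellDenom ((-1) ^ m₁) ((-1) ^ m₂)
      (P - halfTan a₁ m₁ ω - halfTan a₂ m₂ ω) (cosecHalf (halfTan a₁ m₁ ω))
      (cosecHalf (halfTan a₂ m₂ ω)) x := by
  have key : ∀ (a ξ : ℝ) (m : ℤ), ω * a - m * π ∈ Ioo 0 π →
      (Real.cos ξ - Real.cos (ω * a)) / Real.sin (ω * a)
        = halfTan a m ω - (1 - (-1) ^ m * Real.cos ξ) * cosecHalf (halfTan a m ω) := by
    intro a ξ m h
    obtain ⟨hs, hc⟩ := sin_cos_eq_halfTan h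
    have ht := halfTan_pos h
    rw [hs, hc, cosecHalf]
    generalize halfTan a m ω = t at ht ⊢
    have h1 : 0 < 1 + t ^ 2 := by positivity
    rcases neg_one_zpow_eq_one_or m with h | h <;> rw [h] <;> field_simp <;> ring
  rw [fFun, key _ _ _ h1, key _ _ _ h2, cellDenom]
  ring

theorem Dfun_eq_mul {a₁ a₂ a₃ β ω : ℝ} (h1 : Real.sin (ω * a₁) ≠ 0) (h2 : Real.sin (ω * a₂) ≠ 0)
    (h3 : Real.sin (ω * a₃) ≠ 0) (k₁ k₂ : ℝ) :
    Dfun a₁ a₂ a₃ β ω k₁ k₂ = Real.sin (ω * a₁) * Real.sin (ω * a₂) * Real.sin (ω * a₃)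
      * (phiB a₃ β ω - fFun a₁ a₂ k₁ k₂ ω) := by
  unfold Dfun phiB fFun
  field_simp
  ring

theorem sin_ne_zero_of_branch {a ω : ℝ} {m : ℤ} (h : ω * a - m * π ∈ Ioo 0 π) :
    Real.sin (ω * a) ≠ 0 := by
  have := Real.sin_pos_of_mem_Ioo h
  rw [Real.sin_sub_int_mul_pi] at this
  exact right_ne_zero_of_mul this.ne'

theorem phiHalf_anti {c t s : ℝ} (hc : |c| ≤ 1) (ht : 0 < t) (hts : t ≤ s) :
    phiHalf c s ≤ phiHalf c t := by
  obtain ⟨h1, h2⟩ := abs_le.mp hc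
  unfold phiHalf
  have e1 : (1 - c) / (2 * s) ≤ (1 - c) / (2 * t) :=
    div_le_div_of_nonneg_left (by linarith) (by positivity) (by linarith)
  have e2 := mul_le_mul_of_nonneg_left hts (by linarith : 0 ≤ 1 + c)
  linarith

theorem phiHalf_le_inv {c t : ℝ} (hc : |c| ≤ 1) (ht : 0 < t) : phiHalf c t ≤ t⁻¹ := by
  obtain ⟨h1, h2⟩ := abs_le.mp hc
  unfold phiHalf
  have e1 : (1 - c) / (2 * t) ≤ t⁻¹ := by
    rw [inv_eq_one_div, div_le_div_iff₀ (by positivity) ht]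
    nlinarith
  have e2 := mul_nonneg (by linarith : 0 ≤ 1 + c) ht.le
  linarith

theorem exists_mul_cos_eq {σ : ℝ} (hσ : σ = 1 ∨ σ = -1) :
    ∃ s : ℝ, ∀ θ, σ * Real.cos (θ + s) = Real.cos θ := by
  rcases hσ with rfl | rfl
  · exact ⟨0, fun θ => by simp⟩
  · exact ⟨π, fun θ => by rw [Real.cos_add_pi]; ring⟩

/-- In a gap whose left end annihilates `sin (ω a₁)` or `sin (ω a₂)` but whose right end does not,
the mean `I_β` attains every value `L > 1`, at a point where `φ - f` is bounded away from zero. -/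
theorem exists_IB_eq {a₁ a₂ a₃ β ωb ωt L : ℝ} (ha₁ : 0 < a₁) (ha₂ : 0 < a₂) (ha₃ : 0 < a₃)
    (hlt : ωb < ωt) (hL : 1 < L)
    (hgap : ∀ ω ∈ Ioo ωb ωt, ∀ k₁ k₂, Dfun a₁ a₂ a₃ β ω k₁ k₂ ≠ 0)
    (hb : Real.sin (ωb * a₁) = 0 ∨ Real.sin (ωb * a₂) = 0)
    (ht₁ : Real.sin (ωt * a₁) ≠ 0) (ht₂ : Real.sin (ωt * a₂) ≠ 0)
    (ht : ∃ k₁ k₂, Dfun a₁ a₂ a₃ β ωt k₁ k₂ = 0) :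
    ∃ ω ∈ Ioo ωb ωt, (∃ d > 0, ∀ x : ℝ × ℝ, d ≤ |phiB a₃ β ω - fFun a₁ a₂ x.1 x.2 ω|) ∧
      IB a₁ a₂ a₃ β ω = L := by
  have hs₁ : ∀ ω ∈ Ioc ωb ωt, Real.sin (ω * a₁) ≠ 0 := by
    intro ω hω h0
    rcases hω.2.eq_or_lt with rfl | h
    · exact ht₁ h0
    · exact hgap ω ⟨hω.1, h⟩ (ω * a₁) 0 (by simp [Dfun, h0])
  have hs₂ : ∀ ω ∈ Ioc ωb ωt, Real.sin (ω * a₂) ≠ 0 := by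
    intro ω hω h0
    rcases hω.2.eq_or_lt with rfl | h
    · exact ht₂ h0
    · exact hgap ω ⟨hω.1, h⟩ 0 (ω * a₂) (by simp [Dfun, h0])
  set m₁ := ⌊ωb * a₁ / π⌋ with hm₁
  set m₂ := ⌊ωb * a₂ / π⌋ with hm₂
  set m₃ := ⌊ωb * a₃ / π⌋ with hm₃
  set t₁ := halfTan a₁ m₁ with ht₁def
  set t₂ := halfTan a₂ m₂ with ht₂def
  set t₃ := halfTan a₃ m₃ with ht₃def
  set σ₁ : ℝ := (-1) ^ m₁ with hσ₁def
  set σ₂ : ℝ := (-1) ^ m₂ with hσ₂def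
  set c : ℝ := (-1) ^ m₃ * Real.cos β with hcdef
  have hσ₁ : σ₁ = 1 ∨ σ₁ = -1 := neg_one_zpow_eq_one_or m₁
  have hσ₂ : σ₂ = 1 ∨ σ₂ = -1 := neg_one_zpow_eq_one_or m₂
  have hc : |c| ≤ 1 := by
    rw [hcdef, abs_mul, abs_neg_one_zpow, one_mul]; exact Real.abs_cos_le_one β
  have hbr₁ : ∀ ω ∈ Ioc ωb ωt, ω * a₁ - m₁ * π ∈ Ioo 0 π := fun ω => mem_branch ha₁ hs₁
  have hbr₂ : ∀ ω ∈ Ioc ωb ωt, ω * a₂ - m₂ * π ∈ Ioo 0 π := fun ω => mem_branch ha₂ hs₂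
  have hIcc : ∀ {a : ℝ} {m : ℤ}, (∀ ω ∈ Ioc ωb ωt, ω * a - m * π ∈ Ioo 0 π) →
      ωb * a - m * π ∈ Ico 0 π → Icc ωb ωt ⊆ {ω | ω * a - m * π ∈ Ico 0 π} := by
    intro a m h1 h2 ω hω
    rcases hω.1.eq_or_lt with rfl | h
    · exact h2
    · exact Ioo_subset_Ico_self (h1 ω ⟨h, hω.2⟩)
  have h1c := (continuousOn_halfTan a₁ m₁).mono (hIcc hbr₁ (left_mem_branch a₁ ωb))
  have h2c := (continuousOn_halfTan a₂ m₂).mono (hIcc hbr₂ (left_mem_branch a₂ ωb))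
  have h1m := ((strictMonoOn_halfTan ha₁ m₁).mono
    (hIcc hbr₁ (left_mem_branch a₁ ωb))).monotoneOn
  have h2m := ((strictMonoOn_halfTan ha₂ m₂).mono
    (hIcc hbr₂ (left_mem_branch a₂ ωb))).monotoneOn
  have h1p : ∀ ω ∈ Ioc ωb ωt, 0 < t₁ ω := fun ω h => halfTan_pos (hbr₁ ω h)
  have h2p : ∀ ω ∈ Ioc ωb ωt, 0 < t₂ ω := fun ω h => halfTan_pos (hbr₂ ω h)
  have hb0 : t₁ ωb = 0 ∨ t₂ ωb = 0 := hb.imp halfTan_floor_eq_zero halfTan_floor_eq_zero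
  set p := (m₃ + 1) * π / a₃ with hp
  have hb₃ := left_mem_branch a₃ ωb
  have hbp : ωb < p := by
    rw [hp, lt_div_iff₀ ha₃]; linarith [hb₃.2]
  have hbr₃ : ∀ ω ∈ Ioo ωb p, ω * a₃ - m₃ * π ∈ Ioo 0 π := by
    intro ω hω
    have e1 := mul_lt_mul_of_pos_right hω.1 ha₃
    have e2 := hω.2
    rw [hp, lt_div_iff₀ ha₃] at e2
    exact ⟨by linarith [hb₃.1], by linarith⟩
  have h3c : ContinuousOn t₃ (Ioo ωb p) :=
    (continuousOn_halfTan a₃ m₃).mono fun ω h => Ioo_subset_Ico_self (hbr₃ ω h)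
  have h3m : StrictMonoOn t₃ (Ioo ωb p) :=
    (strictMonoOn_halfTan ha₃ m₃).mono fun ω h => Ioo_subset_Ico_self (hbr₃ ω h)
  have h3p : ∀ ω ∈ Ioo ωb p, 0 < t₃ ω := fun ω h => halfTan_pos (hbr₃ ω h)
  set P : ℝ → ℝ := fun ω => phiHalf c (t₃ ω) with hP
  have hPc : ContinuousOn P (Ioo ωb p) := by
    have e1 : ContinuousOn (fun ω => (1 - c) / (2 * t₃ ω)) (Ioo ωb p) :=
      continuousOn_const.div (h3c.const_mul 2) fun ω h => (mul_pos two_pos (h3p ω h)).ne'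
    exact e1.sub ((h3c.const_mul (1 + c)).div_const 2)
  have hPa : AntitoneOn P (Ioo ωb p) := fun x hx y hy hxy =>
    phiHalf_anti hc (h3p x hx) (h3m.monotoneOn hx hy hxy)
  have hden : ∀ ω ∈ Ioc ωb ωt, ω < p → ∀ x : ℝ × ℝ, phiB a₃ β ω - fFun a₁ a₂ x.1 x.2 ω
      = cellDenom σ₁ σ₂ (P ω - t₁ ω - t₂ ω) (cosecHalf (t₁ ω)) (cosecHalf (t₂ ω)) x := by
    intro ω hω hωp x
    rw [phiB_eq_phiHalf (hbr₃ ω ⟨hω.1, hωp⟩)]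
    exact phiHalf_sub_fFun (hbr₁ ω hω) (hbr₂ ω hω) _ x
  have hD : ∀ ω ∈ Ioc ωb ωt, ω < p → ∀ x : ℝ × ℝ, Dfun a₁ a₂ a₃ β ω x.1 x.2 = 0 ↔
      cellDenom σ₁ σ₂ (P ω - t₁ ω - t₂ ω) (cosecHalf (t₁ ω)) (cosecHalf (t₂ ω)) x = 0 := by
    intro ω hω hωp x
    have e3 := sin_ne_zero_of_branch (hbr₃ ω ⟨hω.1, hωp⟩)
    rw [Dfun_eq_mul (hs₁ ω hω) (hs₂ ω hω) e3, hden ω hω hωp]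
    simp [hs₁ ω hω, hs₂ ω hω, e3]
  obtain ⟨r₁, hr₁⟩ := exists_mul_cos_eq hσ₁
  obtain ⟨r₂, hr₂⟩ := exists_mul_cos_eq hσ₂
  have hden_eq : ∀ ω θ, cellDenom σ₁ σ₂ (P ω - t₁ ω - t₂ ω) (cosecHalf (t₁ ω))
      (cosecHalf (t₂ ω)) (θ + r₁, θ + r₂) = P ω - t₁ ω - t₂ ω
        + (1 - Real.cos θ) * (cosecHalf (t₁ ω) + cosecHalf (t₂ ω)) := by
    intro ω θ
    simp only [cellDenom, hr₁, hr₂]; ring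
  have hne : ∀ ω ∈ Ioo ωb ωt, ω < p → ∀ θ, P ω - t₁ ω - t₂ ω
        + (1 - Real.cos θ) * (cosecHalf (t₁ ω) + cosecHalf (t₂ ω)) ≠ 0 := by
    intro ω hω hωp θ h0
    rw [← hden_eq, ← hD ω (Ioo_subset_Ioc_self hω) hωp] at h0
    exact hgap ω hω _ _ h0
  have hδ : ∀ ω ∈ Ioo ωb ωt, ω < p → t₁ ω + t₂ ω < P ω := by
    intro ω hω hωp
    by_contra hcon
    push Not at hcon
    have hneg : P ω - t₁ ω - t₂ ω + 2 * (cosecHalf (t₁ ω) + cosecHalf (t₂ ω)) < 0 := by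
      by_contra hcon2
      push Not at hcon2
      have hcont : ContinuousOn (fun θ => P ω - t₁ ω - t₂ ω
        + (1 - Real.cos θ) * (cosecHalf (t₁ ω) + cosecHalf (t₂ ω))) (Icc 0 π) := by fun_prop
      obtain ⟨θ, -, hθ⟩ := intermediate_value_Icc Real.pi_pos.le hcont
        (show (0 : ℝ) ∈ Icc _ _ from ⟨by simp only [Real.cos_zero]; linarith,
          by simp only [Real.cos_pi]; linarith⟩)
      exact hne ω hω hωp θ hθ
    have hη : 0 < (2 * (|(|P ω|)| + 1))⁻¹ := by positivity
    have hnear : ∃ ω' ∈ Ioo ωb ω, 0 ≤ P ω' - t₁ ω' - t₂ ω'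
        + 2 * (cosecHalf (t₁ ω') + cosecHalf (t₂ ω')) := by
      have e0 : ∀ {t : ℝ}, 0 < t → t ≤ 2 * cosecHalf t := by
        intro t ht
        unfold cosecHalf
        rw [← mul_div_assoc, mul_div_mul_left _ _ two_ne_zero, le_div_iff₀ ht]
        nlinarith
      have e1 : ∀ {t : ℝ}, 0 < t → t < (2 * (|(|P ω|)| + 1))⁻¹ →
          |P ω| + t ≤ 2 * cosecHalf t := by
        intro t ht htη
        have h2 : t ≤ 1 := by
          refine htη.le.trans (inv_le_one_of_one_le₀ ?_)
          linarith [abs_nonneg (|P ω|)]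
        have h3 : t * (2 * (|P ω| + 1)) < 1 := by
          rwa [abs_abs, ← one_div, lt_div_iff₀ (by positivity)] at htη
        unfold cosecHalf
        rw [← mul_div_assoc, mul_div_mul_left _ _ two_ne_zero, le_div_iff₀ ht]
        nlinarith [mul_nonneg ht.le (abs_nonneg (P ω))]
      have hmono : ∀ ω' ∈ Ioo ωb ω, -|P ω| ≤ P ω' := fun ω' h' =>
        (neg_abs_le _).trans (hPa ⟨h'.1, h'.2.trans hωp⟩ ⟨hω.1, hωp⟩ h'.2.le)
      have hmem : ∀ ω' ∈ Ioo ωb ω, ω' ∈ Ioc ωb ωt := fun ω' h' =>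
        ⟨h'.1, (h'.2.trans hω.2).le⟩
      rcases hb0 with hb0 | hb0
      · obtain ⟨ω', h', hlt'⟩ := h1c.exists_lt_of_left_eq_zero hb0 hω.1 hω.2.le hη
        refine ⟨ω', h', ?_⟩
        linarith [e1 (h1p ω' (hmem ω' h')) hlt', e0 (h2p ω' (hmem ω' h')), hmono ω' h']
      · obtain ⟨ω', h', hlt'⟩ := h2c.exists_lt_of_left_eq_zero hb0 hω.1 hω.2.le hη
        refine ⟨ω', h', ?_⟩
        linarith [e1 (h2p ω' (hmem ω' h')) hlt', e0 (h1p ω' (hmem ω' h')), hmono ω' h']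
    obtain ⟨ω', hω', hpos⟩ := hnear
    have hsub : Icc ω' ω ⊆ Ioc ωb ωt := fun x hx =>
      ⟨hω'.1.trans_le hx.1, hx.2.trans hω.2.le⟩
    have hsub₃ : Icc ω' ω ⊆ Ioo ωb p := fun x hx =>
      ⟨hω'.1.trans_le hx.1, hx.2.trans_lt hωp⟩
    have hh : ∀ t : ℝ → ℝ, ContinuousOn t (Icc ω' ω) → (∀ x ∈ Icc ω' ω, 0 < t x) →
        ContinuousOn (fun x => cosecHalf (t x)) (Icc ω' ω) := fun t ht htp =>
      ((ht.pow 2).const_add 1).div (ht.const_mul 2) fun x hx => (mul_pos two_pos (htp x hx)).ne'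
    have c1 := h1c.mono (hsub.trans Ioc_subset_Icc_self)
    have c2 := h2c.mono (hsub.trans Ioc_subset_Icc_self)
    have hcont : ContinuousOn (fun x => P x - t₁ x - t₂ x
        + 2 * (cosecHalf (t₁ x) + cosecHalf (t₂ x))) (Icc ω' ω) :=
      (((hPc.mono hsub₃).sub c1).sub c2).add
        (((hh t₁ c1 fun x hx => h1p x (hsub hx)).add
          (hh t₂ c2 fun x hx => h2p x (hsub hx))).const_mul 2)
    obtain ⟨x, hx, hx0⟩ := intermediate_value_Icc' hω'.2.le hcont
      (show (0 : ℝ) ∈ Icc _ _ from ⟨hneg.le, hpos⟩)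
    refine hne x ⟨(hsub hx).1, hx.2.trans_lt hω.2⟩ (hsub₃ hx).2 π ?_
    rw [Real.cos_pi]
    simp only at hx0
    linarith
  have htp : ωt < p := by
    by_contra hcon
    push Not at hcon
    obtain ⟨ω₀, h0b, h0p⟩ := exists_between hbp
    have h0 : ω₀ ∈ Ioc ωb ωt := ⟨h0b, h0p.le.trans hcon⟩
    set c₀ := t₁ ω₀ + t₂ ω₀ with hc₀
    have hc₀p : 0 < c₀ := add_pos (h1p ω₀ h0) (h2p ω₀ h0)
    have hlt' : max ω₀ ((2 * Real.arctan c₀⁻¹ + m₃ * π) / a₃) < p := by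
      refine max_lt h0p ?_
      rw [hp]
      refine div_lt_div_of_pos_right ?_ ha₃
      linarith [Real.arctan_lt_pi_div_two c₀⁻¹]
    obtain ⟨ω, h1, h2⟩ := exists_between hlt'
    have hω₀ : ω₀ < ω := (le_max_left _ _).trans_lt h1
    have hωb : ωb < ω := h0b.trans hω₀
    have hω : ω ∈ Ioo ωb ωt := ⟨hωb, h2.trans_le hcon⟩
    have hω' := Ioo_subset_Ioc_self hω
    have hθ : Real.arctan c₀⁻¹ < (ω * a₃ - m₃ * π) / 2 := by
      have := (le_max_right _ _).trans_lt h1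
      rw [div_lt_iff₀ ha₃] at this
      linarith
    have hbig : c₀⁻¹ < t₃ ω := by
      have := Real.tan_lt_tan_of_lt_of_lt_pi_div_two (Real.neg_pi_div_two_lt_arctan _)
        (by linarith [(hbr₃ ω ⟨hωb, h2⟩).2]) hθ
      rwa [Real.tan_arctan] at this
    have e1 := h1m (Ioc_subset_Icc_self h0) (Ioc_subset_Icc_self hω') hω₀.le
    have e2 := h2m (Ioc_subset_Icc_self h0) (Ioc_subset_Icc_self hω') hω₀.le
    have e3 := hδ ω hω h2
    have e4 : P ω ≤ (t₃ ω)⁻¹ := phiHalf_le_inv hc (h3p ω ⟨hωb, h2⟩)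
    have e5 : (t₃ ω)⁻¹ < c₀ := by
      rwa [inv_lt_comm₀ (h3p ω ⟨hωb, h2⟩) hc₀p]
    linarith
  have hsub₃ : Ioc ωb ωt ⊆ Ioo ωb p := fun x hx => ⟨hx.1, hx.2.trans_lt htp⟩
  have htmem : ωt ∈ Ioc ωb ωt := ⟨hlt, le_rfl⟩
  have hδ' : ∀ ω ∈ Ioo ωb ωt, t₁ ω + t₂ ω < P ω := fun ω h => hδ ω h (h.2.trans htp)
  have hδt : P ωt = t₁ ωt + t₂ ωt := by
    apply le_antisymm
    · obtain ⟨k₁, k₂, hk⟩ := ht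
      have h0 := (hD ωt htmem htp (k₁, k₂)).mp hk
      have := le_cellDenom hσ₁ hσ₂ (d := P ωt - t₁ ωt - t₂ ωt)
        (cosecHalf_nonneg (h1p ωt htmem)) (cosecHalf_nonneg (h2p ωt htmem)) (k₁, k₂)
      linarith
    · have hcl : ωt ∈ closure (Ioo ωb ωt) := by
        rw [closure_Ioo hlt.ne]; exact right_mem_Icc.mpr hlt.le
      have : (𝓝[Ioo ωb ωt] ωt).NeBot := mem_closure_iff_nhdsWithin_neBot.mp hcl
      have hsI : Ioo ωb ωt ⊆ Icc ωb ωt := Ioo_subset_Icc_self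
      refine le_of_tendsto_of_tendsto
        (((h1c ωt (right_mem_Icc.mpr hlt.le)).mono hsI).add
          ((h2c ωt (right_mem_Icc.mpr hlt.le)).mono hsI))
        ((hPc ωt (hsub₃ htmem)).mono (Ioo_subset_Ioc_self.trans hsub₃)) ?_
      filter_upwards [self_mem_nhdsWithin] with ω hω
      exact (hδ' ω hω).le
  obtain ⟨ω, hω, hωL⟩ := exists_mean_eq hlt hL hσ₁ hσ₂ (hPc.mono hsub₃) (hPa.mono hsub₃)
    h1c h1m h1p h2c h2m h2p hb0 hδ' hδt
  have hω' := Ioo_subset_Ioc_self hω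
  have hωp := hω.2.trans htp
  refine ⟨ω, hω, ⟨P ω - t₁ ω - t₂ ω, by linarith [hδ' ω hω], fun x => ?_⟩, ?_⟩
  · rw [hden ω hω' hωp]
    exact (le_cellDenom hσ₁ hσ₂ (cosecHalf_nonneg (h1p ω hω')) (cosecHalf_nonneg (h2p ω hω'))
      x).trans (le_abs_self _)
  · rw [← hωL, IB, ← integral_const_mul (P ω)]
    congr 1
    refine integral_congr_ae (.of_forall fun x => ?_)
    dsimp only
    rw [hden ω hω' hωp, phiB_eq_phiHalf (hbr₃ ω (hsub₃ hω')), div_eq_mul_inv]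

theorem Dfun_neg (a₁ a₂ a₃ β ω k₁ k₂ : ℝ) :
    Dfun a₁ a₂ a₃ β (-ω) k₁ k₂ = Dfun a₁ a₂ a₃ β ω k₁ k₂ := by
  simp only [Dfun, neg_mul, Real.sin_neg, Real.cos_neg]
  ring

theorem phiB_neg (a₃ β ω : ℝ) : phiB a₃ β (-ω) = -phiB a₃ β ω := by
  simp only [phiB, neg_mul, Real.sin_neg, Real.cos_neg, div_neg]

theorem fFun_neg (a₁ a₂ ξ η ω : ℝ) : fFun a₁ a₂ ξ η (-ω) = -fFun a₁ a₂ ξ η ω := by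
  simp only [fFun, neg_mul, Real.sin_neg, Real.cos_neg, div_neg]
  ring

theorem IB_neg (a₁ a₂ a₃ β ω : ℝ) : IB a₁ a₂ a₃ β (-ω) = IB a₁ a₂ a₃ β ω := by
  have h (p : ℝ × ℝ) : -phiB a₃ β ω / (-phiB a₃ β ω - -fFun a₁ a₂ p.1 p.2 ω)
      = phiB a₃ β ω / (phiB a₃ β ω - fFun a₁ a₂ p.1 p.2 ω) := by
    rw [← neg_sub', neg_div_neg_eq]
  simp only [IB, phiB_neg, fFun_neg, h]

theorem sin_mul_eq_zero_iff_exists {a ω : ℝ} (ha : 0 < a) (hω : 0 < ω) :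
    Real.sin (ω * a) = 0 ↔ ∃ n : ℕ, 1 ≤ n ∧ ω = π * n / a := by
  rw [Real.sin_eq_zero_iff]
  constructor
  · rintro ⟨n, hn⟩
    have hn0 : 0 < n := by
      have : 0 < (n : ℝ) * π := by rw [hn]; positivity
      exact_mod_cast pos_of_mul_pos_left this Real.pi_pos.le
    refine ⟨n.toNat, by omega, ?_⟩
    have hcast : ((n.toNat : ℕ) : ℝ) = (n : ℝ) := by
      exact_mod_cast Int.toNat_of_nonneg hn0.le
    rw [hcast, eq_div_iff ha.ne', ← hn, mul_comm]
  · rintro ⟨n, -, rfl⟩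
    exact ⟨n, by rw [div_mul_cancel₀ _ ha.ne', mul_comm]; simp⟩

theorem mem_Tset_iff {a₁ a₂ ω : ℝ} (ha₁ : 0 < a₁) (ha₂ : 0 < a₂) (hω : 0 < ω) :
    ω ∈ Tset a₁ a₂ ↔ Real.sin (ω * a₁) = 0 ∨ Real.sin (ω * a₂) = 0 := by
  rw [sin_mul_eq_zero_iff_exists ha₁ hω, sin_mul_eq_zero_iff_exists ha₂ hω]
  rfl

theorem IsGap.Dfun_ne_zero {a₁ a₂ a₃ β ωb ωt : ℝ} (h : IsGap a₁ a₂ a₃ β ωb ωt) {ω : ℝ}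
    (hω : ω ∈ Ioo ωb ωt) (k₁ k₂ : ℝ) : Dfun a₁ a₂ a₃ β ω k₁ k₂ ≠ 0 := by
  intro h0
  have hc : ∀ k, Real.cos (Real.arccos (Real.cos k)) = Real.cos k := fun k =>
    Real.cos_arccos (Real.neg_one_le_cos k) (Real.cos_le_one k)
  have hmem : ω ∈ Ioo ωb ωt ∩ dispSet a₁ a₂ a₃ β :=
    ⟨hω, h.1.trans hω.1, _, ⟨Real.arccos_nonneg (Real.cos k₁), Real.arccos_le_pi _⟩, _,
      ⟨Real.arccos_nonneg (Real.cos k₂), Real.arccos_le_pi _⟩, by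
        rw [← h0]; simp only [Dfun, hc]⟩
  rw [h.2.2.2.2] at hmem
  exact hmem

/-- for `0 < μ < 1`, a gap of type (ii) or (iii) contains at least
one eigenvalue. -/
theorem stmt15 (a₁ a₂ a₃ β μ : ℝ) (ha₁ : 0 < a₁) (ha₂ : 0 < a₂) (ha₃ : 0 < a₃)
    (hβ : β ∈ Icc (0 : ℝ) π) (hμ0 : 0 < μ) (hμ1 : μ < 1)
    (ωb ωt : ℝ) (hgap : IsGap a₁ a₂ a₃ β ωb ωt)
    (htype : (ωb ∈ Tset a₁ a₂ ∧ ωt ∉ Tset a₁ a₂ ∧ Ioo ωb ωt ∩ Wset a₃ β = ∅) ∨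
      (ωb ∉ Tset a₁ a₂ ∧ ωt ∈ Tset a₁ a₂ ∧ Ioo ωb ωt ∩ Wset a₃ β = ∅)) :
    ∃ ω₁ ∈ Ioo ωb ωt,
      (∃ u : ℤ × ℤ → ℂ, (Summable fun p : ℤ × ℤ => ‖u p‖ ^ 2) ∧ u ≠ 0 ∧
          SatisfiesFD a₁ a₂ a₃ β μ ω₁ u) ∧
      μ = 1 - FB a₁ a₂ a₃ β ω₁ := by
  have hL : 1 < (1 - μ)⁻¹ := (one_lt_inv₀ (by linarith)).mpr (by linarith)
  have hωt : 0 < ωt := hgap.1.trans hgap.2.1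
  have key : ∃ ω ∈ Ioo ωb ωt,
      (∃ d > 0, ∀ x : ℝ × ℝ, d ≤ |phiB a₃ β ω - fFun a₁ a₂ x.1 x.2 ω|) ∧
        IB a₁ a₂ a₃ β ω = (1 - μ)⁻¹ := by
    rcases htype with ⟨hb, ht, -⟩ | ⟨hb, ht, -⟩
    · rw [mem_Tset_iff ha₁ ha₂ hgap.1] at hb
      rw [mem_Tset_iff ha₁ ha₂ hωt, not_or] at ht
      obtain ⟨-, k₁, -, k₂, -, hk⟩ := hgap.2.2.2.1
      exact exists_IB_eq ha₁ ha₂ ha₃ hgap.2.1 hL (fun ω hω => hgap.Dfun_ne_zero hω) hb ht.1 ht.2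
        ⟨k₁, k₂, hk⟩
    · rw [mem_Tset_iff ha₁ ha₂ hgap.1, not_or] at hb
      rw [mem_Tset_iff ha₁ ha₂ hωt] at ht
      obtain ⟨-, k₁, -, k₂, -, hk⟩ := hgap.2.2.1
      obtain ⟨ω, hω, ⟨d, hd, hdle⟩, hI⟩ := exists_IB_eq (β := β) ha₁ ha₂ ha₃
        (neg_lt_neg hgap.2.1) hL
        (fun ω hω k₁ k₂ => by
          rw [← Dfun_neg]
          exact hgap.Dfun_ne_zero ⟨by linarith [hω.2], by linarith [hω.1]⟩ k₁ k₂)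
        (by simpa using ht) (by simpa using hb.1) (by simpa using hb.2)
        ⟨k₁, k₂, by rw [Dfun_neg]; exact hk⟩
      refine ⟨-ω, ⟨by linarith [hω.2], by linarith [hω.1]⟩, ⟨d, hd, fun x => ?_⟩, ?_⟩
      · rw [phiB_neg, fFun_neg, ← neg_sub', abs_neg]; exact hdle x
      · rw [IB_neg]; exact hI
  obtain ⟨ω, hω, ⟨d, hd, hdle⟩, hI⟩ := key
  refine ⟨ω, hω, exists_l2_solution hd hdle ?_, ?_⟩
  · rw [hI, mul_inv_cancel₀ (by linarith)]
  · rw [FB, hI, inv_inv]; ring
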